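/- arXiv:2411.06095 — 3 statements merged into one kernel-verified Lean document; each statement's English description precedes it below -/
import Mathlib

section
/- Let w_D < w_H < w_H' < w_L < w_G be real numbers. The collusion threshold ρ*(η) = (w_G − (η·w_H' + (1-η)·w_L)) / (w_G − (η·w_H' + (1-η)·w_L) + (w_H − w_D)) is strictly increasing in η on [0,1]: for all 0 ≤ η₁ < η₂ ≤ 1, ρ*(η₁) < ρ*(η₂). -/
/-- For `c > 0`, the map `x ↦ x / (x + c)` is strictly increasing on the nonnegative reals. -/
theorem div_add_const_lt_div_add_const {a b c : ℝ} (ha : 0 ≤ a) (hab : a < b) (hc : 0 < c) :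
    a / (a + c) < b / (b + c) := by
  rw [div_lt_div_iff₀ (by linarith) (by linarith)]
  linarith [mul_lt_mul_of_pos_right hab hc]

/-- The collusion threshold ρ*(η) is strictly increasing in η on [0,1]. -/
theorem collusion_threshold_strict_mono
    (wD wH wH' wL wG : ℝ)
    (h1 : wD < wH) (h2 : wH < wH') (h3 : wH' < wL) (h4 : wL < wG)
    (η₁ η₂ : ℝ) (hη₁ : 0 ≤ η₁) (hlt : η₁ < η₂) (hη₂ : η₂ ≤ 1) :
    (wG - (η₁ * wH' + (1 - η₁) * wL)) /
        (wG - (η₁ * wH' + (1 - η₁) * wL) + (wH - wD))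
      < (wG - (η₂ * wH' + (1 - η₂) * wL)) /
          (wG - (η₂ * wH' + (1 - η₂) * wL) + (wH - wD)) := by
  have gap_nonneg : 0 ≤ wG - (η₁ * wH' + (1 - η₁) * wL) := by
    linarith [mul_nonneg hη₁ (sub_pos.2 h3).le]
  have gap_lt : wG - (η₁ * wH' + (1 - η₁) * wL) < wG - (η₂ * wH' + (1 - η₂) * wL) := by
    linarith [mul_pos (sub_pos.2 hlt) (sub_pos.2 h3)]
  exact div_add_const_lt_div_add_const gap_nonneg gap_lt (sub_pos.2 h1)
end

section
/- Let w_D < w_H < w_H' < w_L < w_G be real numbers. The collusion threshold ρ*(η) = (w_G − (η·w_H' + (1-η)·w_L)) / (w_G − (η·w_H' + (1-η)·w_L) + (w_H − w_D)) is strictly concave in η on [0,1]: for all η₁, η₂ ∈ [0,1] with η₁ ≠ η₂, ρ*((η₁+η₂)/2) > (ρ*(η₁) + ρ*(η₂))/2. -/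
/-- The map `x ↦ x / (x + c)` with `0 < c` is strictly midpoint-concave on the positive reals. -/
theorem midpoint_div_add_const_lt {c x y : ℝ} (hc : 0 < c) (hx : 0 < x) (hy : 0 < y)
    (hxy : x ≠ y) :
    (x / (x + c) + y / (y + c)) / 2 < (x + y) / 2 / ((x + y) / 2 + c) := by
  have gap : (x + y) / 2 / ((x + y) / 2 + c) - (x / (x + c) + y / (y + c)) / 2
      = c * (x - y) ^ 2 / (2 * (x + c) * (y + c) * (x + y + 2 * c)) := by
    have : (x + y) / 2 + c ≠ 0 := by positivity
    have : x + y + 2 * c ≠ 0 := by positivity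
    have : x + c ≠ 0 := by positivity
    have : y + c ≠ 0 := by positivity
    field_simp
    ring
  have : 0 < (x - y) ^ 2 := sq_pos_of_ne_zero (sub_ne_zero.mpr hxy)
  have : 0 < c * (x - y) ^ 2 / (2 * (x + c) * (y + c) * (x + y + 2 * c)) := by positivity
  linarith

/-- The collusion threshold ρ*(η) is strictly midpoint-concave (strictly concave) on [0,1]. -/
theorem collusion_threshold_strict_concave
    (wD wH wH' wL wG : ℝ)
    (h1 : wD < wH) (h2 : wH < wH') (h3 : wH' < wL) (h4 : wL < wG)
    (η₁ η₂ : ℝ) (hη₁0 : 0 ≤ η₁) (hη₁1 : η₁ ≤ 1) (hη₂0 : 0 ≤ η₂) (hη₂1 : η₂ ≤ 1)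
    (hne : η₁ ≠ η₂) :
    (wG - (((η₁ + η₂) / 2) * wH' + (1 - (η₁ + η₂) / 2) * wL)) /
        (wG - (((η₁ + η₂) / 2) * wH' + (1 - (η₁ + η₂) / 2) * wL) + (wH - wD))
      > ((wG - (η₁ * wH' + (1 - η₁) * wL)) /
            (wG - (η₁ * wH' + (1 - η₁) * wL) + (wH - wD))
          + (wG - (η₂ * wH' + (1 - η₂) * wL)) /
            (wG - (η₂ * wH' + (1 - η₂) * wL) + (wH - wD))) / 2 := by
  have pos : ∀ η : ℝ, 0 ≤ η → 0 < wG - (η * wH' + (1 - η) * wL) := fun η hη => by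
    nlinarith [mul_nonneg hη (sub_nonneg.mpr h3.le)]
  have ne : wG - (η₁ * wH' + (1 - η₁) * wL) ≠ wG - (η₂ * wH' + (1 - η₂) * wL) := fun h =>
    hne (mul_right_cancel₀ (sub_ne_zero.mpr h3.ne') (by linarith))
  have mid : wG - (((η₁ + η₂) / 2) * wH' + (1 - (η₁ + η₂) / 2) * wL)
      = (wG - (η₁ * wH' + (1 - η₁) * wL) + (wG - (η₂ * wH' + (1 - η₂) * wL))) / 2 := by
    ring
  rw [mid]
  exact midpoint_div_add_const_lt (sub_pos.mpr h1) (pos η₁ hη₁0) (pos η₂ hη₂0) ne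
end

section
/- Let w_D < w_H < w_H' < w_L < w_G and g > d > 0, and suppose ((g − d)/d)·((w_H − w_D)/(w_G − w_H')) > 1. Define ρ* = (g − d)(w_G − w_L) / ((g − d)(w_G − w_L) + (g − d)(w_H − w_D) − d(w_L − w_H')), ρ^L = (w_G − w_L)/(w_G − w_L + w_H − w_D), and ρ^H = (w_G − w_H')/(w_G − w_H' + w_H − w_D). Then 0 < ρ* < 1 and ρ^L < ρ* < ρ^H. -/
/-- Under `((g−d)/d)·((w_H−w_D)/(w_G−w_H')) > 1`, the mixed-strategy collusion threshold
ρ* satisfies `0 < ρ* < 1` and `ρ^L < ρ* < ρ^H`. -/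
theorem mixed_threshold_bounds
    (wD wH wH' wL wG g d : ℝ)
    (h1 : wD < wH) (h2 : wH < wH') (h3 : wH' < wL) (h4 : wL < wG)
    (hgd : g > d) (hd : d > 0)
    (hcond : ((g - d) / d) * ((wH - wD) / (wG - wH')) > 1) :
    0 < (g - d) * (wG - wL) /
          ((g - d) * (wG - wL) + (g - d) * (wH - wD) - d * (wL - wH')) ∧
    (g - d) * (wG - wL) /
          ((g - d) * (wG - wL) + (g - d) * (wH - wD) - d * (wL - wH')) < 1 ∧
    (wG - wL) / (wG - wL + (wH - wD))
      < (g - d) * (wG - wL) /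
          ((g - d) * (wG - wL) + (g - d) * (wH - wD) - d * (wL - wH')) ∧
    (g - d) * (wG - wL) /
          ((g - d) * (wG - wL) + (g - d) * (wH - wD) - d * (wL - wH'))
      < (wG - wH') / (wG - wH' + (wH - wD)) := by
  have hB : 0 < wH - wD := by linarith
  have hA : 0 < wG - wL := by linarith
  have hC : 0 < wL - wH' := by linarith
  have hAC : 0 < wG - wH' := by linarith
  have he : 0 < g - d := by linarith
  have key : d * (wG - wH') < (g - d) * (wH - wD) := by
    rw [gt_iff_lt, div_mul_div_comm, one_lt_div (mul_pos hd hAC)] at hcond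
    exact hcond
  have hdA : 0 < d * (wG - wL) := mul_pos hd hA
  have hnum : 0 < (g - d) * (wG - wL) := mul_pos he hA
  have hgap : 0 < (g - d) * (wH - wD) - d * (wL - wH') := by linarith
  have hden : 0 < (g - d) * (wG - wL) + (g - d) * (wH - wD) - d * (wL - wH') := by linarith
  refine ⟨div_pos hnum hden, ?_, ?_, ?_⟩
  · rw [div_lt_one hden]
    linarith
  · rw [div_lt_div_iff₀ (by linarith) hden]
    linarith [mul_pos hdA hC]
  · rw [div_lt_div_iff₀ hden (by linarith)]
    linarith [mul_pos hC (sub_pos.mpr key)]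
end
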